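/- Let λ > 1 and set δ(λ−1) := max{4(λ−1)−1, 2(λ−1)}. Then there exist a constant C > 0 and N ∈ ℕ such that for all n ≥ N, |∫₀¹ (1−x²)·[C_{n−1}^{(λ+1)}(x)]² dx − ((2λ−1)/(4(λ−1)·Γ(2λ+1)²))·n^{4λ−2}| ≤ C·n^{δ(λ−1)+2}. -/

import Mathlib

open Real MeasureTheory Finset

/-- Gegenbauer polynomials `C_n^{(λ)}`: `C_0 = 1`, `C_1 = 2λx`, and
`n C_n(x) = 2(n+λ-1) x C_{n-1}(x) - (n+2λ-2) C_{n-2}(x)` for `n ≥ 2`. -/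
noncomputable def gegenbauer (lam : ℝ) : ℕ → ℝ → ℝ
  | 0, _ => 1
  | 1, x => 2 * lam * x
  | n + 2, x =>
      (2 * ((n : ℝ) + 1 + lam) * x * gegenbauer lam (n + 1) x
        - ((n : ℝ) + 2 * lam) * gegenbauer lam n x) / ((n : ℝ) + 2)

namespace GegAux

lemma geg_rec (lam : ℝ) (n : ℕ) (x : ℝ) :
    ((n : ℝ) + 2) * gegenbauer lam (n + 2) x =
      2 * ((n : ℝ) + 1 + lam) * x * gegenbauer lam (n + 1) x
        - ((n : ℝ) + 2 * lam) * gegenbauer lam n x := by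
  have h : ((n : ℝ) + 2) ≠ 0 := by positivity
  rw [gegenbauer]
  field_simp

/-- integer-indexed Gegenbauer polynomials for the parameter 3/2 -/
noncomputable def D (k : ℤ) (x : ℝ) : ℝ := if k < 0 then 0 else gegenbauer (3/2) k.toNat x

lemma D_neg {k : ℤ} (h : k < 0) (x : ℝ) : D k x = 0 := by simp [D, h]

lemma D_nat (k : ℕ) (x : ℝ) : D (k : ℤ) x = gegenbauer (3/2) k x := by
  simp [D]

lemma D_zero (x : ℝ) : D 0 x = 1 := by
  simp [D, gegenbauer]

lemma D_one (x : ℝ) : D 1 x = 3 * x := by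
  simp only [D, gegenbauer, Int.toNat_one]; norm_num [gegenbauer]

lemma D_rec (k : ℤ) (x : ℝ) :
    (2 * (k : ℝ) + 3) * (x * D k x) = ((k : ℝ) + 1) * D (k + 1) x + ((k : ℝ) + 2) * D (k - 1) x := by
  rcases lt_or_ge k 0 with h | h
  · rw [D_neg h, D_neg (k := k - 1) (by omega)]
    rcases eq_or_ne k (-1) with h1 | h1
    · subst h1; simp
    · rw [D_neg (k := k + 1) (by omega)]; simp
  · obtain ⟨n, rfl⟩ := Int.eq_ofNat_of_zero_le h
    rcases n with _ | n
    · simp only [Nat.cast_zero, Int.cast_zero, zero_add, zero_sub]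
      rw [D_zero, D_one, D_neg (by norm_num)]; ring
    · have e1 : ((n + 1 : ℕ) : ℤ) + 1 = ((n + 2 : ℕ) : ℤ) := by push_cast; ring
      have e2 : ((n + 1 : ℕ) : ℤ) - 1 = ((n : ℕ) : ℤ) := by push_cast; ring
      rw [e1, e2, D_nat, D_nat, D_nat]
      have := geg_rec (3/2) n x
      push_cast
      linear_combination -this

/-- coefficient sequences -/
noncomputable def A (a t : ℝ) : ℝ := Real.Gamma (t + a) / Real.Gamma (t + 1)
noncomputable def B (a t : ℝ) : ℝ := Real.Gamma (t + a + 3/2) / Real.Gamma (t + 5/2)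

lemma A_neg_one (a : ℝ) : A a (-1) = 0 := by simp [A, Real.Gamma_zero]

lemma A_rec (a : ℝ) (ha : 0 < a) (j : ℝ) (hj : 0 ≤ j) : (j + 1) * A a (j + 1) = (j + a) * A a j := by
  unfold A
  have h1 : Real.Gamma (j + 1 + a) = (j + a) * Real.Gamma (j + a) := by
    rw [← Real.Gamma_add_one (by positivity)]; congr 1; ring
  rw [h1, Real.Gamma_add_one (s := j + 1) (by positivity)]
  have := (Real.Gamma_pos_of_pos (s := j + 1) (by positivity)).ne'
  have h2 : j + 1 ≠ 0 := by positivity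
  field_simp

lemma B_rec (a : ℝ) (ha : 0 < a) (j : ℝ) (hj : 0 ≤ j) :
    (j + 5/2) * B a (j + 1) = (j + a + 3/2) * B a j := by
  unfold B
  have h1 : Real.Gamma (j + 1 + a + 3/2) = (j + a + 3/2) * Real.Gamma (j + a + 3/2) := by
    rw [← Real.Gamma_add_one (by positivity)]; congr 1; ring
  have h3 : Real.Gamma (j + 1 + 5/2) = (j + 5/2) * Real.Gamma (j + 5/2) := by
    rw [← Real.Gamma_add_one (by positivity)]; congr 1; ring
  rw [h1, h3]
  have := (Real.Gamma_pos_of_pos (s := j + 5/2) (by positivity)).ne'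
  have h2 : j + 5/2 ≠ 0 := by positivity
  field_simp

/-- terms of the connection formula -/
noncomputable def W (a : ℝ) (x : ℝ) (p : ℕ × ℕ) : ℝ :=
  ((p.2 : ℝ) - p.1 + 3/2) * A a p.1 * B a p.2 * D ((p.2 : ℤ) - p.1) x

noncomputable def S (a : ℝ) (x : ℝ) (m : ℕ) : ℝ := ∑ p ∈ antidiagonal m, W a x p

lemma S_rec (a : ℝ) (ha : 0 < a) (x : ℝ) (m : ℕ) :
    ((m : ℝ) + 2) * S a x (m + 2) =
      2 * ((m : ℝ) + 1 + (a + 3/2)) * x * S a x (m + 1) - ((m : ℝ) + 2 * (a + 3/2)) * S a x m := by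
  set f1 : ℕ × ℕ → ℝ := fun p => A a p.1 * B a ((p.2 : ℝ) - 1) * ((p.2 : ℝ) - p.1) * D ((p.2 : ℤ) - p.1) x
    with hf1
  set f2 : ℕ × ℕ → ℝ := fun p => A a ((p.1 : ℝ) - 1) * B a p.2 * ((p.2 : ℝ) - p.1 + 3) * D ((p.2 : ℤ) - p.1) x
    with hf2
  set f3 : ℕ × ℕ → ℝ := fun p => A a ((p.1 : ℝ) - 1) * B a ((p.2 : ℝ) - 1) * ((p.2 : ℝ) - p.1 + 3/2)
    * D ((p.2 : ℤ) - p.1) x with hf3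
  have e3 : S a x m = ∑ p ∈ antidiagonal (m + 2), f3 p := by
    rw [Finset.Nat.sum_antidiagonal_succ, Finset.Nat.sum_antidiagonal_succ']
    have z1 : f3 (0, m + 1 + 1) = 0 := by simp [hf3, A_neg_one]
    have z2 : f3 (m + 1, 0) = 0 := by
      simp only [hf3]; rw [D_neg (by push_cast; omega)]; simp
    simp only [z1, S, W]
    have z3 : f3 (m + 1 + 1, 0) = 0 := by
      simp only [hf3]; rw [D_neg (by push_cast; omega)]; simp
    simp only [z3, zero_add]
    apply Finset.sum_congr rfl
    rintro ⟨j, l⟩ _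
    simp only [hf3]
    push_cast
    rw [show (l : ℤ) + 1 - (j + 1) = l - j by ring]
    simp only [add_sub_cancel_right]
    ring
  have e12 : 2 * x * S a x (m + 1) = ∑ p ∈ antidiagonal (m + 2), (f1 p + f2 p) := by
    rw [Finset.sum_add_distrib, Finset.Nat.sum_antidiagonal_succ',
      Finset.Nat.sum_antidiagonal_succ (f := f2)]
    have z1 : f2 (0, m + 1 + 1) = 0 := by simp [hf2, A_neg_one]
    have z2 : f1 (m + 1 + 1, 0) = 0 := by
      simp only [hf1]; rw [D_neg (by push_cast; omega)]; simp
    rw [z1, z2, zero_add, zero_add, S, Finset.mul_sum, ← Finset.sum_add_distrib]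
    apply Finset.sum_congr rfl
    rintro ⟨j, l⟩ _
    have := D_rec ((l : ℤ) - j) x
    simp only [hf1, hf2, W]
    push_cast at this ⊢
    rw [show (l : ℤ) + 1 - j = l - j + 1 by ring, show (l : ℤ) - (j + 1) = l - j - 1 by ring]
    simp only [add_sub_cancel_right]
    linear_combination (A a j * B a l) * this
  have : 2 * ((m : ℝ) + 1 + (a + 3/2)) * x * S a x (m + 1)
      = ((m : ℝ) + 1 + (a + 3/2)) * (2 * x * S a x (m + 1)) := by ring
  rw [this, e12, e3, S, Finset.mul_sum, Finset.mul_sum, Finset.mul_sum, ← Finset.sum_sub_distrib]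
  apply Finset.sum_congr rfl
  rintro ⟨j, l⟩ hjl
  rw [HasAntidiagonal.mem_antidiagonal] at hjl
  simp only at hjl
  have hm : (m : ℝ) = j + l - 2 := by
    have : (j : ℝ) + l = m + 2 := by exact_mod_cast hjl
    linarith
  simp only [hf1, hf2, hf3, W]
  rcases lt_or_ge l j with h | h
  · rw [D_neg (by omega)]; simp
  obtain ⟨l, rfl⟩ : ∃ l', l = l' + 1 := ⟨l - 1, by omega⟩
  have hB := B_rec a ha l (by positivity)
  rcases j with _ | j
  · push_cast at *
    rw [zero_sub, A_neg_one, add_sub_cancel_right, hm]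
    linear_combination ((l : ℝ) + 1) * A a 0 * D (l + 1 - 0) x * hB
  · have hA := A_rec a ha j (by positivity)
    push_cast at *
    rw [add_sub_cancel_right, add_sub_cancel_right, hm]
    have hA' : A a (j + 1) = (j + a) * A a j / (j + 1) := by
      rw [eq_div_iff (by positivity)]; linarith
    have hB' : B a (l + 1) = (l + a + 3/2) * B a l / (l + 5/2) := by
      rw [eq_div_iff (by positivity)]; linarith
    have h1 : (j : ℝ) + 1 ≠ 0 := by positivity
    have h2 : (l : ℝ) + 5/2 ≠ 0 := by positivity
    rw [hA', hB']
    have h3 : (l : ℝ) * 2 + 5 ≠ 0 := by positivity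
    field_simp
    ring

lemma A_pos (a : ℝ) (ha : 0 < a) (t : ℝ) (ht : 0 ≤ t) : 0 < A a t :=
  div_pos (Real.Gamma_pos_of_pos (by positivity)) (Real.Gamma_pos_of_pos (by positivity))

lemma B_pos (a : ℝ) (ha : 0 < a) (t : ℝ) (ht : 0 ≤ t) : 0 < B a t :=
  div_pos (Real.Gamma_pos_of_pos (by positivity)) (Real.Gamma_pos_of_pos (by positivity))

lemma connection (a : ℝ) (ha : 0 < a) (x : ℝ) (m : ℕ) :
    3/2 * A a 0 * B a 0 * gegenbauer (a + 3/2) m x = S a x m := by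
  induction m using Nat.strong_induction_on with
  | _ m ih =>
    rcases m with _ | _ | m
    · simp [S, W, gegenbauer, D_zero]
    · have hB := B_rec a ha 0 le_rfl
      simp only [S, Finset.Nat.sum_antidiagonal_succ, W, gegenbauer]
      simp [D_one, D_neg]
      simp at hB
      linear_combination -3 * x * A a 0 * hB
    · have h0 := ih m (by omega)
      have h1 := ih (m + 1) (by omega)
      have hr := geg_rec (a + 3/2) m x
      have hs := S_rec a ha x m
      rw [← h0, ← h1] at hs
      have h2 : ((m : ℝ) + 2) ≠ 0 := by positivity
      apply mul_left_cancel₀ h2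
      linear_combination (3/2 * A a 0 * B a 0) * hr - hs

end GegAux

namespace GegAux

noncomputable def Gd (k : ℕ) (x : ℝ) : ℝ := deriv (gegenbauer (3/2) k) x

lemma geg_diff (lam : ℝ) (k : ℕ) : Differentiable ℝ (gegenbauer lam k) := by
  induction k using Nat.strong_induction_on with
  | _ k ih =>
    rcases k with _ | _ | k
    · have : gegenbauer lam 0 = fun _ => 1 := by ext x; simp [gegenbauer]
      rw [this]; fun_prop
    · have : gegenbauer lam (0 + 1) = fun x => 2 * lam * x := by ext x; simp [gegenbauer]
      rw [this]; fun_prop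
    · have h0 := ih k (by omega)
      have h1 := ih (k + 1) (by omega)
      have : gegenbauer lam (k + 1 + 1) = fun x => (2 * ((k : ℝ) + 1 + lam) * x * gegenbauer lam (k + 1) x
        - ((k : ℝ) + 2 * lam) * gegenbauer lam k x) / ((k : ℝ) + 2) := by
        ext x; rw [gegenbauer]
      rw [this]; fun_prop

lemma geg_cont (lam : ℝ) (k : ℕ) : Continuous (gegenbauer lam k) := (geg_diff lam k).continuous

lemma geg_parity (lam : ℝ) (k : ℕ) (x : ℝ) : gegenbauer lam k (-x) = (-1) ^ k * gegenbauer lam k x := by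
  induction k using Nat.strong_induction_on with
  | _ k ih =>
    rcases k with _ | _ | k
    · simp [gegenbauer]
    · simp [gegenbauer]
    · have h0 := ih k (by omega)
      have h1 := ih (k + 1) (by omega)
      have hr := geg_rec lam k x
      have hr' := geg_rec lam k (-x)
      rw [h0, h1] at hr'
      have h2 : ((k : ℝ) + 2) ≠ 0 := by positivity
      apply mul_left_cancel₀ h2
      rw [show k + 1 + 1 = k + 2 from rfl, hr', pow_succ, pow_succ]
      linear_combination -(-1) ^ k * hr

lemma Dhas (k : ℕ) (x : ℝ) : HasDerivAt (D (k : ℤ)) (Gd k x) x := by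
  have : D (k : ℤ) = gegenbauer (3/2) k := by ext x; exact D_nat k x
  rw [this]
  exact (geg_diff _ k x).hasDerivAt

lemma Gd_eq (k : ℕ) (x : ℝ) :
    (1 - x ^ 2) * Gd k x = ((k : ℝ) + 2) * D ((k : ℤ) - 1) x - k * x * D k x := by
  induction k using Nat.strong_induction_on with
  | _ k ih =>
    rcases k with _ | _ | k
    · have : gegenbauer (3/2) 0 = fun _ => 1 := by ext x; simp [gegenbauer]
      simp [Gd, this, D_neg]
    · have : gegenbauer (3/2) (0 + 1) = fun x => 3 * x := by
        ext x; norm_num [gegenbauer]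
      have h : Gd (0 + 1) x = 3 := by
        rw [Gd, this]
        simp
      rw [h]
      simp [D_zero, D_one]
      ring
    · have h0 := ih k (by omega)
      have h1 := ih (k + 1) (by omega)
      have hr : ∀ x, D ((k : ℤ) + 2) x * (k + 2) = (2 * (k : ℝ) + 5) * (x * D ((k : ℤ) + 1) x) - (k + 3) * D k x := by
        intro x
        have := D_rec ((k : ℤ) + 1) x
        rw [show (k : ℤ) + 1 + 1 = k + 2 by ring, show (k : ℤ) + 1 - 1 = k by ring] at this
        push_cast at this
        linear_combination -this
      have hd2 := Dhas (k + 2) x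
      have hd1 := Dhas (k + 1) x
      have hd0 := Dhas k x
      push_cast at hd2 hd1 h1 ⊢
      have hk : ((k : ℝ) + 2) * Gd (k + 2) x
          = (2 * (k : ℝ) + 5) * (D ((k : ℤ) + 1) x + x * Gd (k + 1) x) - (k + 3) * Gd k x := by
        have e1 := hd2.mul_const ((k : ℝ) + 2)
        have e2 := (((hasDerivAt_id x).mul hd1).const_mul (2 * (k : ℝ) + 5)).sub (hd0.const_mul ((k : ℝ) + 3))
        have e3 : (fun y => D ((k : ℤ) + 2) y * ((k : ℝ) + 2)) = fun y =>
          (2 * (k : ℝ) + 5) * (y * D ((k : ℤ) + 1) y) - (k + 3) * D k y := by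
          ext y; exact hr y
        rw [e3] at e1
        have := e1.unique e2
        simp at this
        linear_combination this
      have hr0 := D_rec (k : ℤ) x
      have hr1 := hr x
      push_cast at hr0
      rw [show (k : ℤ) + 1 - 1 = k by ring] at h1
      rw [show k + 1 + 1 = k + 2 from rfl, show (k : ℤ) + 1 + 1 - 1 = k + 1 by ring,
        show (k : ℤ) + 1 + 1 = k + 2 by ring]
      have h2 : ((k : ℝ) + 2) ≠ 0 := by positivity
      apply mul_left_cancel₀ h2
      linear_combination (1 - x^2) * hk + (2 * (k : ℝ) + 5) * x * h1 - (k + 3) * h0 + (k + 2) * x * hr1 + (k + 3) * hr0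

lemma D_cont (k : ℤ) : Continuous (D k) := by
  rcases lt_or_ge k 0 with h | h
  · have : D k = fun _ => 0 := by ext x; exact D_neg h x
    rw [this]; fun_prop
  · obtain ⟨n, rfl⟩ := Int.eq_ofNat_of_zero_le h
    have : D ((n : ℕ) : ℤ) = gegenbauer (3/2) n := by ext x; exact D_nat n x
    exact this ▸ geg_cont _ n

noncomputable def br (k l : ℤ) : ℝ := ∫ x in (-1 : ℝ)..1, (1 - x ^ 2) * (D k x * D l x)

lemma br_comm (k l : ℤ) : br k l = br l k := by
  unfold br; congr 1; ext x; ring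

lemma br_neg {k : ℤ} (l : ℤ) (hk : k < 0) : br k l = 0 := by
  unfold br; simp [D_neg hk]

lemma br_cont (k l : ℤ) : Continuous (fun x : ℝ => (1 - x ^ 2) * (D k x * D l x)) := by
  have := D_cont k
  have := D_cont l
  fun_prop

lemma br_x (k l : ℤ) : (2 * (k : ℝ) + 3) * ∫ x in (-1 : ℝ)..1, (1 - x ^ 2) * (x * (D k x * D l x))
    = ((k : ℝ) + 1) * br (k + 1) l + ((k : ℝ) + 2) * br (k - 1) l := by
  unfold br
  rw [← intervalIntegral.integral_const_mul, ← intervalIntegral.integral_const_mul,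
    ← intervalIntegral.integral_const_mul, ← intervalIntegral.integral_add]
  · congr 1; ext x
    linear_combination (1 - x ^ 2) * D l x * D_rec k x
  · exact ((br_cont _ _).const_mul _).intervalIntegrable _ _
  · exact ((br_cont _ _).const_mul _).intervalIntegrable _ _

lemma br_swap (k l : ℤ) :
    (2 * (l : ℝ) + 3) * (((k : ℝ) + 1) * br (k + 1) l + ((k : ℝ) + 2) * br (k - 1) l)
    = (2 * (k : ℝ) + 3) * (((l : ℝ) + 1) * br k (l + 1) + ((l : ℝ) + 2) * br k (l - 1)) := by
  rw [br_comm k (l + 1), br_comm k (l - 1), ← br_x k l, ← br_x l k]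
  have : (∫ x in (-1 : ℝ)..1, (1 - x ^ 2) * (x * (D k x * D l x)))
    = ∫ x in (-1 : ℝ)..1, (1 - x ^ 2) * (x * (D l x * D k x)) := by
    congr 1; ext x; ring
  rw [this]; ring

lemma br_zero (k : ℕ) : br ((k : ℤ) + 1) 0 = 0 := by
  unfold br
  have hF : ∀ x, HasDerivAt (fun x : ℝ => (1 - x ^ 2) * (((k : ℝ) + 3) * D k x - (k + 1) * x * D ((k : ℤ) + 1) x))
      (-(((k : ℝ) + 1) * (k + 4)) * ((1 - x ^ 2) * (D ((k : ℤ) + 1) x * D 0 x))) x := by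
    intro x
    have hd1 := Dhas (k + 1) x
    have hd0 := Dhas k x
    push_cast at hd1
    have h0 := Gd_eq k x
    have h1 := Gd_eq (k + 1) x
    have hr := D_rec k x
    push_cast at h1 hr
    rw [show (k : ℤ) + 1 - 1 = k by ring] at h1
    have := ((hasDerivAt_const x (1 : ℝ)).sub (hasDerivAt_pow 2 x)).mul
      ((hd0.const_mul ((k : ℝ) + 3)).sub (((hasDerivAt_id x).const_mul ((k : ℝ) + 1)).mul hd1))
    refine this.congr_deriv ?_
    simp [D_zero]
    linear_combination ((k : ℝ) + 3) * h0 - (k + 1) * x * h1 - (k + 3) * hr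
  have hc : Continuous (fun x : ℝ => -(((k : ℝ) + 1) * (k + 4)) * ((1 - x ^ 2) * (D ((k : ℤ) + 1) x * D 0 x))) :=
    (br_cont _ _).const_mul _
  have := intervalIntegral.integral_eq_sub_of_hasDerivAt (a := -1) (b := 1) (fun x _ => hF x)
    (hc.intervalIntegrable _ _)
  rw [intervalIntegral.integral_const_mul] at this
  norm_num at this
  rcases this with (h | h) | h
  · exact absurd h (by positivity)
  · exact absurd h (by positivity)
  · exact h

lemma br_lt (l : ℕ) : ∀ k : ℕ, l < k → br (k : ℤ) (l : ℤ) = 0 := by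
  induction l using Nat.strong_induction_on with
  | _ l ih =>
    intro k hk
    obtain ⟨k, rfl⟩ : ∃ k', k = k' + 1 := ⟨k - 1, by omega⟩
    rcases l with _ | l
    · exact_mod_cast br_zero k
    · have h := br_swap ((k : ℤ) + 1) l
      have h1 := ih l (by omega) (k + 2) (by omega)
      have h2 := ih l (by omega) k (by omega)
      have h3 : br ((k : ℤ) + 1) ((l : ℤ) - 1) = 0 := by
        rcases l with _ | l
        · rw [br_comm]; exact br_neg _ (by norm_num)
        · have := ih l (by omega) (k + 1) (by omega)
          push_cast at this ⊢
          simpa using this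
      push_cast at h1 h2 h ⊢
      rw [show (k : ℤ) + 1 + 1 = k + 2 by ring, show (k : ℤ) + 1 - 1 = k by ring, h1, h2, h3] at h
      simp at h
      rcases h with h | h | h
      · exact absurd h (by positivity)
      · exact absurd h (by positivity)
      · exact h

lemma br_ne {k l : ℤ} (h : k ≠ l) : br k l = 0 := by
  rcases lt_or_ge k 0 with hk | hk
  · exact br_neg _ hk
  rcases lt_or_ge l 0 with hl | hl
  · rw [br_comm]; exact br_neg _ hl
  obtain ⟨n, rfl⟩ := Int.eq_ofNat_of_zero_le hk
  obtain ⟨m, rfl⟩ := Int.eq_ofNat_of_zero_le hl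
  rcases lt_or_gt_of_ne h with h | h
  · rw [br_comm]; exact br_lt n m (by exact_mod_cast h)
  · exact br_lt m n (by exact_mod_cast h)

lemma br_self (k : ℕ) : br (k : ℤ) k = ((k : ℝ) + 1) * (k + 2) / (k + 3/2) := by
  induction k with
  | zero =>
    unfold br
    simp [D_zero]
    norm_num
  | succ k ih =>
    have h := br_swap ((k : ℤ) + 1) k
    rw [show (k : ℤ) + 1 - 1 = k by ring, br_ne (k := (k : ℤ) + 1 + 1) (l := k) (by omega),
      br_ne (k := (k : ℤ) + 1) (l := (k : ℤ) - 1) (by omega), ih] at h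
    push_cast at h ⊢
    have h1 : (k : ℝ) + 1 ≠ 0 := by positivity
    have h2 : 2 * (k : ℝ) + 3 ≠ 0 := by positivity
    have h3 : 2 * ((k : ℝ) + 1) + 3 ≠ 0 := by positivity
    have h4 : 2 * (((k : ℝ) + 1) + 3/2) ≠ 0 := by positivity
    have h5 : (k : ℝ) + 1 + 3/2 ≠ 0 := by positivity
    have h6 : (k : ℝ) + 3/2 ≠ 0 := by positivity
    rw [eq_div_iff h5]
    apply mul_left_cancel₀ h1
    field_simp at h
    linear_combination -(1/2 : ℝ) * h

end GegAux

namespace GegAux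

noncomputable def g (a : ℝ) (m j : ℝ) : ℝ := A a j ^ 2 * B a (m - j) ^ 2
noncomputable def Nn (m j : ℝ) : ℝ := m - 2 * j + 3/2
noncomputable def T (a : ℝ) (m : ℕ) : ℝ :=
  ∑ j ∈ range (m / 2 + 1), g a m j * (Nn m j * (Nn m j ^ 2 - 1/4))

lemma int_S (a : ℝ) (m : ℕ) :
    ∫ x in (-1 : ℝ)..1, (1 - x ^ 2) * S a x m ^ 2 = T a m := by
  set w : ℕ × ℕ → ℝ := fun p => ((p.2 : ℝ) - p.1 + 3/2) * A a p.1 * B a p.2 with hw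
  have h1 : ∀ x, (1 - x ^ 2) * S a x m ^ 2 = ∑ p ∈ HasAntidiagonal.antidiagonal m,
      ∑ q ∈ HasAntidiagonal.antidiagonal m, w p * w q *
        ((1 - x ^ 2) * (D ((p.2 : ℤ) - p.1) x * D ((q.2 : ℤ) - q.1) x)) := by
    intro x
    rw [pow_two (S a x m), S, Finset.sum_mul_sum, Finset.mul_sum]
    apply Finset.sum_congr rfl; intro p _
    rw [Finset.mul_sum]
    apply Finset.sum_congr rfl; intro q _
    simp only [W, hw]; ring
  simp_rw [h1]
  rw [intervalIntegral.integral_finsetSum]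
  swap
  · intro p _
    apply Continuous.intervalIntegrable
    exact continuous_finsetSum _ (fun q _ => (br_cont _ _).const_mul _)
  have h2 : ∀ p ∈ HasAntidiagonal.antidiagonal m,
      ∫ x in (-1 : ℝ)..1, ∑ q ∈ HasAntidiagonal.antidiagonal m, w p * w q *
        ((1 - x ^ 2) * (D ((p.2 : ℤ) - p.1) x * D ((q.2 : ℤ) - q.1) x))
      = w p * w p * br ((p.2 : ℤ) - p.1) ((p.2 : ℤ) - p.1) := by
    intro p hp
    rw [intervalIntegral.integral_finsetSum]
    swap
    · intro q _
      exact ((br_cont _ _).const_mul _).intervalIntegrable _ _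
    simp_rw [intervalIntegral.integral_const_mul]
    rw [Finset.sum_eq_single_of_mem p hp]
    · rfl
    · intro q hq hqp
      have : br ((p.2 : ℤ) - p.1) ((q.2 : ℤ) - q.1) = 0 := by
        apply br_ne
        intro h
        apply hqp
        rw [HasAntidiagonal.mem_antidiagonal] at hp hq
        ext <;> omega
      unfold br at this
      rw [this, mul_zero]
  rw [Finset.sum_congr rfl h2, Finset.Nat.sum_antidiagonal_eq_sum_range_succ_mk, T]
  symm
  have hsub : range (m / 2 + 1) ⊆ range m.succ := by
    intro j; simp only [Finset.mem_range]; omega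
  rw [← Finset.sum_subset hsub]
  · apply Finset.sum_congr rfl
    intro j hj
    rw [Finset.mem_range] at hj
    simp only
    obtain ⟨k, hk⟩ : ∃ k : ℕ, m - j = k + j := ⟨m - 2 * j, by omega⟩
    have hm : (m : ℝ) = k + 2 * j := by
      have : m = k + 2 * j := by omega
      rw [this]; push_cast; ring
    simp only [hw, g, Nn]
    rw [hk, show ((k + j : ℕ) : ℤ) - j = k by push_cast; ring, br_self, hm]
    push_cast
    rw [show (k : ℝ) + 2 * j - j = k + j by ring]
    have : (k : ℝ) + 3/2 ≠ 0 := by positivity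
    have : (k : ℝ) * 2 + 3 ≠ 0 := by positivity
    field_simp
    ring
  · intro j hj hj'
    simp only [Finset.mem_range] at hj hj'
    simp only
    rw [br_neg _ (by omega), mul_zero]

lemma int_formula (a : ℝ) (ha : 0 < a) (m : ℕ) :
    (3/2 * A a 0 * B a 0) ^ 2 * ∫ x in (0 : ℝ)..1, (1 - x ^ 2) * gegenbauer (a + 3/2) m x ^ 2
      = T a m / 2 := by
  have hc : Continuous (fun x : ℝ => (1 - x ^ 2) * gegenbauer (a + 3/2) m x ^ 2) := by
    have := geg_cont (a + 3/2) m
    fun_prop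
  have h1 : ∫ x in (-1 : ℝ)..0, (1 - x ^ 2) * gegenbauer (a + 3/2) m x ^ 2
      = ∫ x in (0 : ℝ)..1, (1 - x ^ 2) * gegenbauer (a + 3/2) m x ^ 2 := by
    have := intervalIntegral.integral_comp_neg (a := 0) (b := 1)
      (fun x : ℝ => (1 - x ^ 2) * gegenbauer (a + 3/2) m x ^ 2)
    rw [neg_zero] at this
    rw [← this]
    congr 1; ext x
    rw [geg_parity, mul_pow, ← pow_mul, mul_comm m 2, pow_mul]
    simp
  have h2 := intervalIntegral.integral_add_adjacent_intervals
    (hc.intervalIntegrable (μ := volume) (-1) 0) (hc.intervalIntegrable (μ := volume) 0 1)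
  rw [h1] at h2
  have h3 := int_S a m
  have h4 : ∀ x, (1 - x ^ 2) * S a x m ^ 2 =
      (3/2 * A a 0 * B a 0) ^ 2 * ((1 - x ^ 2) * gegenbauer (a + 3/2) m x ^ 2) := by
    intro x; rw [← connection a ha]; ring
  simp_rw [h4] at h3
  rw [intervalIntegral.integral_const_mul, ← h2] at h3
  linarith

/-! ### Gamma ratio -/

lemma gr_upper (a z : ℝ) (ha : 0 < a) (ha1 : a < 1) (hz : 0 < z) :
    Real.Gamma (z + a) ≤ Real.Gamma z * z ^ a := by
  have h := Real.Gamma_mul_add_mul_le_rpow_Gamma_mul_rpow_Gamma (s := z) (t := z + 1) (a := 1 - a)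
    (b := a) hz (by linarith) (by linarith) ha (by ring)
  have hG := Real.Gamma_pos_of_pos hz
  rw [Real.Gamma_add_one hz.ne', Real.mul_rpow hz.le hG.le] at h
  calc Real.Gamma (z + a) = Real.Gamma ((1 - a) * z + a * (z + 1)) := by congr 1; ring
    _ ≤ _ := h
    _ = (Real.Gamma z ^ (1 - a) * Real.Gamma z ^ a) * z ^ a := by ring
    _ = _ := by rw [← Real.rpow_add hG]; simp

lemma gr_base (a z : ℝ) (ha : 0 < a) (ha1 : a < 1) (hz : 1 ≤ z) :
    |Real.Gamma (z + a) / Real.Gamma z - z ^ a| ≤ z ^ (a - 1) := by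
  have hz0 : 0 < z := by linarith
  have hG := Real.Gamma_pos_of_pos hz0
  have hu : Real.Gamma (z + a) / Real.Gamma z ≤ z ^ a := by
    rw [div_le_iff₀ hG]; linarith [gr_upper a z ha ha1 hz0]
  have hp : 0 < z ^ (a - 1) := Real.rpow_pos_of_pos hz0 _
  rw [abs_le]
  constructor
  · have h := gr_upper (1 - a) (z + a) (by linarith) (by linarith) (by linarith)
    rw [show z + a + (1 - a) = z + 1 by ring, Real.Gamma_add_one hz0.ne'] at h
    set r := Real.Gamma (z + a) / Real.Gamma z with hr
    have hr' : Real.Gamma (z + a) = r * Real.Gamma z := by rw [hr]; field_simp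
    rw [hr'] at h
    have h2 : z ≤ r * (z + a) ^ (1 - a) := by
      have : z * Real.Gamma z ≤ (r * (z + a) ^ (1 - a)) * Real.Gamma z := by linarith
      exact le_of_mul_le_mul_right this hG
    have hr0 : 0 ≤ r := by
      rw [hr]; exact div_nonneg (Real.Gamma_pos_of_pos (by linarith)).le hG.le
    have h3 : (z + a) ^ (1 - a) ≤ (z + 1) / z * z ^ (1 - a) := by
      have e : z + a ≤ ((z + 1) / z) * z := by field_simp; linarith
      have e1 : 1 ≤ (z + 1) / z := by rw [le_div_iff₀ hz0]; linarith
      calc (z + a) ^ (1 - a) ≤ (((z + 1) / z) * z) ^ (1 - a) :=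
            Real.rpow_le_rpow (by linarith) e (by linarith)
        _ = ((z + 1) / z) ^ (1 - a) * z ^ (1 - a) := Real.mul_rpow (by positivity) hz0.le
        _ ≤ ((z + 1) / z) * z ^ (1 - a) := by
            gcongr
            calc ((z + 1) / z) ^ (1 - a) ≤ ((z + 1) / z) ^ (1 : ℝ) :=
                  Real.rpow_le_rpow_of_exponent_le e1 (by linarith)
              _ = _ := Real.rpow_one _
    have h4 : z ≤ r * ((z + 1) / z * z ^ (1 - a)) := h2.trans (by gcongr)
    have h5 : z ^ (1 - a) * z ^ (a - 1) = 1 := by rw [← Real.rpow_add hz0]; simp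
    have h6 : z ^ a = z * z ^ (a - 1) := by
      rw [mul_comm, ← Real.rpow_add_one hz0.ne']; congr 1; ring
    rw [h6]
    have h7 : z * z * z ^ (a - 1) ≤ r * (z + 1) := by
      have := mul_le_mul_of_nonneg_right h4 hp.le
      have e : r * ((z + 1) / z * z ^ (1 - a)) * z ^ (a - 1) = r * (z + 1) / z := by
        linear_combination (r * (z + 1) / z) * h5
      rw [e, le_div_iff₀ hz0] at this
      linarith
    have h8 : (z - 1) * z ^ (a - 1) * (z + 1) ≤ r * (z + 1) := by nlinarith
    have := le_of_mul_le_mul_right h8 (by linarith)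
    linarith
  · linarith

lemma gr (a : ℝ) (ha : 0 ≤ a) : ∃ C : ℝ, 0 < C ∧ ∀ z : ℝ, 1 ≤ z →
    |Real.Gamma (z + a) / Real.Gamma z - z ^ a| ≤ C * z ^ (a - 1) := by
  obtain ⟨k, hk⟩ : ∃ k : ℕ, a < k + 1 := ⟨⌊a⌋₊, Nat.lt_floor_add_one a⟩
  induction k generalizing a with
  | zero =>
    refine ⟨1, one_pos, fun z hz => ?_⟩
    rw [one_mul]
    rcases ha.eq_or_lt with h | h
    · subst h
      have hG := Real.Gamma_pos_of_pos (show 0 < z by linarith)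
      rw [add_zero, div_self hG.ne', Real.rpow_zero, sub_self, abs_zero]
      positivity
    · exact gr_base a z h (by simpa using hk) hz
  | succ k ih =>
    rcases lt_or_ge a 1 with h1 | h1
    · refine ih a ha (lt_of_lt_of_le h1 ?_)
      have : (0 : ℝ) ≤ k := by positivity
      linarith
    · obtain ⟨C, hC, h⟩ := ih (a - 1) (by linarith) (by push_cast at hk; linarith)
      refine ⟨C + a * (C + 1), by positivity, fun z hz => ?_⟩
      have hz0 : 0 < z := by linarith
      have hG := Real.Gamma_pos_of_pos hz0
      have e1 : Real.Gamma (z + a) = (z + (a - 1)) * Real.Gamma (z + (a - 1)) := by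
        rw [← Real.Gamma_add_one (by linarith)]; congr 1; ring
      have hz' := h z hz
      set r := Real.Gamma (z + (a - 1)) / Real.Gamma z with hr
      have e2 : Real.Gamma (z + a) / Real.Gamma z = (z + (a - 1)) * r := by
        rw [e1, hr]; ring
      have e3 : z ^ a = z * z ^ (a - 1) := by
        rw [mul_comm, ← Real.rpow_add_one hz0.ne']; congr 1; ring
      have e4 : z ^ (a - 1) = z * z ^ (a - 1 - 1) := by
        rw [mul_comm, ← Real.rpow_add_one hz0.ne']; congr 1; ring
      have hp : 0 < z ^ (a - 1 - 1) := Real.rpow_pos_of_pos hz0 _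
      rw [e2, e3]
      have e5 : (z + (a - 1)) * r - z * z ^ (a - 1)
        = (z + (a - 1)) * (r - z ^ (a - 1)) + (a - 1) * z ^ (a - 1) := by ring
      rw [e5]
      calc _ ≤ |(z + (a - 1)) * (r - z ^ (a - 1))| + |(a - 1) * z ^ (a - 1)| := abs_add_le _ _
        _ = (z + (a - 1)) * |r - z ^ (a - 1)| + (a - 1) * z ^ (a - 1) := by
          rw [abs_mul, abs_mul, abs_of_nonneg (show 0 ≤ z + (a - 1) by linarith),
            abs_of_nonneg (show 0 ≤ a - 1 by linarith), abs_of_nonneg (show 0 ≤ z ^ (a - 1) by positivity)]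
        _ ≤ (z + (a - 1)) * (C * z ^ (a - 1 - 1)) + (a - 1) * z ^ (a - 1) := by
          gcongr
        _ ≤ _ := by
          rw [e4]
          have : z ^ (a - 1 - 1) ≤ z * z ^ (a - 1 - 1) := by nlinarith
          have h2 : (a - 1) * C * z ^ (a - 1 - 1) ≤ (a - 1) * C * (z * z ^ (a - 1 - 1)) :=
            mul_le_mul_of_nonneg_left this (mul_nonneg (by linarith) hC.le)
          have h3 : 0 ≤ C * (z * z ^ (a - 1 - 1)) := by positivity
          have h4 : 0 ≤ (z * z ^ (a - 1 - 1)) := by positivity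
          nlinarith

lemma rpow_comp (K s t b : ℝ) (hK : 1 ≤ K) (ht : 0 < t) (h1 : t ≤ K * s) (h2 : s ≤ K * t) :
    s ^ b ≤ K ^ |b| * t ^ b := by
  have hs : 0 < s := by
    by_contra h
    have : K * s ≤ 0 := mul_nonpos_of_nonneg_of_nonpos (by linarith) (by linarith)
    linarith
  have hK0 : 0 < K := by linarith
  rcases le_total 0 b with hb | hb
  · rw [abs_of_nonneg hb, ← Real.mul_rpow hK0.le ht.le]
    exact Real.rpow_le_rpow hs.le h2 hb
  · rw [abs_of_nonpos hb]
    have h3 : (K * s) ^ b ≤ t ^ b := Real.rpow_le_rpow_of_nonpos ht h1 hb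
    rw [Real.mul_rpow hK0.le hs.le] at h3
    have h4 : K ^ (-b) * K ^ b = 1 := by rw [← Real.rpow_add hK0]; simp
    calc s ^ b = K ^ (-b) * (K ^ b * s ^ b) := by rw [← mul_assoc, h4, one_mul]
      _ ≤ _ := by gcongr

lemma rpow_diff (K a s t c : ℝ) (hK : 1 ≤ K) (ht : 0 < t) (h1 : t ≤ K * s) (h2 : s ≤ K * t)
    (hc : |s - t| ≤ c) : |s ^ a - t ^ a| ≤ |a| * K ^ |a - 1| * c * t ^ (a - 1) := by
  have hK0 : 0 < K := by linarith
  have hmem : ∀ x ∈ Set.Icc (t / K) (K * t), t ≤ K * x ∧ x ≤ K * t ∧ 0 < x := by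
    intro x hx
    have hx1 := hx.1
    rw [div_le_iff₀ hK0] at hx1
    refine ⟨by linarith, hx.2, lt_of_lt_of_le (by positivity) hx.1⟩
  have h := Convex.norm_image_sub_le_of_norm_hasDerivWithin_le
    (f := fun x : ℝ => x ^ a) (f' := fun x => a * x ^ (a - 1)) (C := |a| * K ^ |a - 1| * t ^ (a - 1))
    (s := Set.Icc (t / K) (K * t)) (x := t) (y := s) (fun x hx =>
      (Real.hasDerivAt_rpow_const (Or.inl (hmem x hx).2.2.ne')).hasDerivWithinAt) (fun x hx => by
        obtain ⟨q1, q2, q3⟩ := hmem x hx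
        rw [Real.norm_eq_abs, abs_mul, abs_of_nonneg (Real.rpow_nonneg q3.le _), mul_assoc]
        gcongr
        exact rpow_comp K x t (a - 1) hK ht q1 q2) (convex_Icc _ _)
    (by constructor
        · rw [div_le_iff₀ hK0]; nlinarith
        · nlinarith)
    (by constructor
        · rw [div_le_iff₀ hK0]; linarith
        · exact h2)
  simp only [Real.norm_eq_abs] at h
  refine h.trans ?_
  have : 0 ≤ |a| * K ^ |a - 1| * t ^ (a - 1) := by positivity
  nlinarith

lemma sum_bound (q : ℝ) : ∃ C : ℝ, 0 < C ∧ ∀ i : ℕ, ∀ s : ℝ, 1 ≤ s → (i : ℝ) ≤ s →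
    ∑ j ∈ range i, ((j : ℝ) + 1) ^ (q - 2) ≤ C * s ^ (max q 0) := by
  rcases le_or_gt q 0 with hq | hq
  · have hs : Summable (fun j : ℕ => ((j : ℝ) + 1) ^ (-2 : ℝ)) := by
      have := (Real.summable_nat_rpow (p := -2)).2 (by norm_num)
      have := (summable_nat_add_iff 1).2 this
      simpa using this
    refine ⟨∑' j : ℕ, ((j : ℝ) + 1) ^ (-2 : ℝ) + 1, ?_, ?_⟩
    · have : 0 ≤ ∑' j : ℕ, ((j : ℝ) + 1) ^ (-2 : ℝ) := tsum_nonneg (fun j => by positivity)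
      linarith
    · intro i s _ _
      rw [max_eq_right hq, Real.rpow_zero, mul_one]
      have h1 : ∑ j ∈ range i, ((j : ℝ) + 1) ^ (q - 2) ≤ ∑ j ∈ range i, ((j : ℝ) + 1) ^ (-2 : ℝ) := by
        apply Finset.sum_le_sum
        intro j _
        apply Real.rpow_le_rpow_of_exponent_le
        · have : (0 : ℝ) ≤ j := by positivity
          linarith
        · linarith
      have h2 := hs.sum_le_tsum (range i) (fun j _ => by positivity)
      linarith
  · rw [max_eq_left hq.le]
    have hle : ∀ i : ℕ, ∑ j ∈ range i, ((j : ℝ) + 1) ^ (q - 2) ≤ ∑ j ∈ range i, ((j : ℝ) + 1) ^ (q - 1) := by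
      intro i
      apply Finset.sum_le_sum
      intro j _
      apply Real.rpow_le_rpow_of_exponent_le
      · have : (0 : ℝ) ≤ j := by positivity
        linarith
      · linarith
    rcases le_or_gt 1 q with h1 | h1
    · refine ⟨1, one_pos, fun i s hs his => (hle i).trans ?_⟩
      calc ∑ j ∈ range i, ((j : ℝ) + 1) ^ (q - 1) ≤ ∑ j ∈ range i, s ^ (q - 1) := by
            apply Finset.sum_le_sum
            intro j hj
            apply Real.rpow_le_rpow (by positivity) _ (by linarith)
            have : j + 1 ≤ i := Finset.mem_range.1 hj
            have : (j : ℝ) + 1 ≤ i := by exact_mod_cast this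
            linarith
        _ = i * s ^ (q - 1) := by simp
        _ ≤ s * s ^ (q - 1) := by gcongr
        _ = 1 * s ^ q := by
          rw [mul_comm, ← Real.rpow_add_one (by linarith), one_mul]; congr 1; ring
    · refine ⟨1 / q, by positivity, fun i s hs his => (hle i).trans ?_⟩
      have key : ∑ j ∈ range i, ((j : ℝ) + 1) ^ (q - 1) ≤ 1 / q * (i : ℝ) ^ q := by
        clear his
        induction i with
        | zero => simp [hq.ne']
        | succ i ih =>
          rw [Finset.sum_range_succ]
          have hi : (0 : ℝ) < (i : ℝ) + 1 := by positivity
          have e1 : (i : ℝ) ^ q ≤ ((i : ℝ) + 1) ^ q * (1 + q * (-(1 / ((i : ℝ) + 1)))) := by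
            have hb := rpow_one_add_le_one_add_mul_self (s := -(1 / ((i : ℝ) + 1))) (p := q)
              (by rw [neg_le_neg_iff, div_le_one hi]; linarith [(Nat.cast_nonneg i : (0:ℝ) ≤ i)]) hq.le h1.le
            have e : (i : ℝ) = ((i : ℝ) + 1) * (1 + -(1 / ((i : ℝ) + 1))) := by field_simp; ring
            have e0 : 0 ≤ 1 + -(1 / ((i : ℝ) + 1)) := by
              have : 1 / ((i : ℝ) + 1) ≤ 1 := by
                rw [div_le_one hi]; linarith [(Nat.cast_nonneg i : (0:ℝ) ≤ i)]
              linarith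
            conv_lhs => rw [e]
            rw [Real.mul_rpow hi.le e0]
            gcongr
          have e2 : ((i : ℝ) + 1) ^ q = ((i : ℝ) + 1) ^ (q - 1) * (i + 1) := by
            rw [← Real.rpow_add_one hi.ne']; congr 1; ring
          have e3 : (i : ℝ) ^ q ≤ ((i : ℝ) + 1) ^ q - q * ((i : ℝ) + 1) ^ (q - 1) := by
            refine e1.trans (le_of_eq ?_)
            rw [e2]; field_simp; ring
          push_cast
          have : 1 / q * (i : ℝ) ^ q ≤ 1 / q * (((i : ℝ) + 1) ^ q - q * ((i : ℝ) + 1) ^ (q - 1)) := by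
            gcongr
          have e4 : 1 / q * (((i : ℝ) + 1) ^ q - q * ((i : ℝ) + 1) ^ (q - 1))
            = 1 / q * ((i : ℝ) + 1) ^ q - ((i : ℝ) + 1) ^ (q - 1) := by field_simp
          linarith
      refine key.trans ?_
      gcongr

end GegAux

namespace GegAux

noncomputable def Rn (a m j : ℝ) : ℝ := g a m j * (j + a) ^ 2 * (m - j + 3/2) ^ 2
noncomputable def Vn (a m j : ℝ) : ℝ := (j + a/2 + 1/2) * (m - j + a/2 + 1)
noncomputable def un (a m j : ℝ) : ℝ := (j + a/2) * (m - j + a/2 + 3/2)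
noncomputable def En (a m j : ℝ) : ℝ :=
  (1 - a ^ 2) / 4 * ((2 * a - 2) * (un a m j - 1/4) - (1 - a ^ 2) / 4) - (a - 1) ^ 2 * Nn m j ^ 2 / 4
noncomputable def en (a m j : ℝ) : ℝ := En a m j / (Vn a m j * Vn a m (j - 1))

lemma g_rec (a : ℝ) (ha : 0 < a) (m j : ℝ) (hj : 0 ≤ j) (hjm : j + 1 ≤ m) :
    Rn a m j = g a m (j + 1) * (j + 1) ^ 2 * (m - j + a + 1/2) ^ 2 := by
  have hA := A_rec a ha j hj
  have hB := B_rec a ha (m - (j + 1)) (by linarith)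
  rw [show m - (j + 1) + 1 = m - j by ring, show m - (j + 1) + 5/2 = m - j + 3/2 by ring,
    show m - (j + 1) + a + 3/2 = m - j + a + 1/2 by ring] at hB
  unfold Rn g
  calc A a j ^ 2 * B a (m - j) ^ 2 * (j + a) ^ 2 * (m - j + 3/2) ^ 2
      = ((j + a) * A a j) ^ 2 * ((m - j + 3/2) * B a (m - j)) ^ 2 := by ring
    _ = _ := by rw [← hA, hB]; ring

lemma R_sum (a : ℝ) (ha : 0 < a) (m i : ℕ) (him : i ≤ m) :
    ∑ j ∈ range (i + 1), g a m j * (2 * a * Nn m j * (un a m j - a ^ 2 / 4)) = Rn a m i := by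
  induction i with
  | zero => simp [Rn, Nn, un]; ring
  | succ i ih =>
    have him' : (i : ℝ) + 1 ≤ m := by exact_mod_cast him
    rw [Finset.sum_range_succ, ih (by omega), g_rec a ha m i (by positivity) him']
    push_cast
    simp only [Rn, Nn, un]
    ring

lemma Vn_pos (a : ℝ) (ha : 0 < a) (m j : ℝ) (hj : 0 ≤ j) (hm : j ≤ m) : 0 < Vn a m j := by
  unfold Vn
  apply mul_pos <;> linarith

lemma Q_sum (a : ℝ) (ha : 0 < a) (m i : ℕ) (him : i ≤ m) :
    ∑ j ∈ range i, g a m (j + 1) * (Nn m (j + 1) * (2 * a - 1 + en a m (j + 1)))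
      = Rn a m i / Vn a m i - Rn a m 0 / Vn a m 0 := by
  induction i with
  | zero => simp
  | succ i ih =>
    have him' : (i : ℝ) + 1 ≤ m := by exact_mod_cast him
    have h1 := Vn_pos a ha m i (by positivity) (by linarith)
    have h2 := Vn_pos a ha m (i + 1) (by positivity) him'
    rw [Finset.sum_range_succ, ih (by omega), g_rec a ha m i (by positivity) him']
    push_cast
    have h3 : g a m (i + 1) * (Nn m (i + 1) * (2 * a - 1 + en a m (i + 1)))
       = Rn a m (i + 1) / Vn a m (i + 1) - g a m (i + 1) * (i + 1) ^ 2 * (m - i + a + 1/2) ^ 2 / Vn a m i := by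
      unfold en
      rw [add_sub_cancel_right]
      field_simp
      simp only [En, Rn, Nn, un, Vn]
      ring
    rw [h3]; ring

/-- upper bound for `A` -/
lemma A_le (a : ℝ) (ha : 0 < a) : ∃ C : ℝ, 0 < C ∧ ∀ j : ℝ, 1 ≤ j → A a j ≤ C * j ^ (a - 1) := by
  obtain ⟨C, hC, h⟩ := gr a ha.le
  refine ⟨C + 1, by positivity, fun j hj => ?_⟩
  have hj0 : 0 < j := by linarith
  have e : A a j = (Real.Gamma (j + a) / Real.Gamma j) / j := by
    unfold A; rw [Real.Gamma_add_one hj0.ne']; 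
    have := (Real.Gamma_pos_of_pos hj0).ne'
    field_simp
  rw [e, div_le_iff₀ hj0]
  have h1 := (abs_le.1 (h j hj)).2
  have h2 : j ^ a = j ^ (a - 1) * j := by rw [← Real.rpow_add_one hj0.ne']; congr 1; ring
  have h3 : 0 < j ^ (a - 1) := Real.rpow_pos_of_pos hj0 _
  rw [h2] at h1
  nlinarith [mul_le_mul_of_nonneg_left hj (mul_pos hC h3).le]

lemma B_eq (a l : ℝ) (hl : 0 ≤ l) :
    (l + 3/2) * B a l = Real.Gamma (l + 3/2 + a) / Real.Gamma (l + 3/2) := by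
  unfold B
  rw [show l + 5/2 = (l + 3/2) + 1 by ring, Real.Gamma_add_one (by positivity),
    show l + a + 3/2 = l + 3/2 + a by ring]
  have := (Real.Gamma_pos_of_pos (show 0 < l + 3/2 by positivity)).ne'
  field_simp

lemma B_le (a : ℝ) (ha : 0 < a) : ∃ C : ℝ, 0 < C ∧ ∀ m j : ℝ, 0 ≤ j → 2 * j ≤ m →
    B a (m - j) ≤ C * (m + 1) ^ (a - 1) := by
  obtain ⟨C, hC, h⟩ := gr a ha.le
  refine ⟨(C + 1) * 2 ^ |a - 1|, by positivity, fun m j hj hm => ?_⟩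
  set z := m - j + 3/2 with hz
  have hz1 : 1 ≤ z := by rw [hz]; linarith
  have hz0 : 0 < z := by linarith
  have e := B_eq a (m - j) (by linarith)
  rw [← hz] at e
  have h1 := (abs_le.1 (h z hz1)).2
  rw [← e] at h1
  have h2 : z ^ a = z ^ (a - 1) * z := by rw [← Real.rpow_add_one hz0.ne']; congr 1; ring
  have h3 : 0 < z ^ (a - 1) := Real.rpow_pos_of_pos hz0 _
  rw [h2] at h1
  have h4 : z * B a (m - j) ≤ z * ((C + 1) * z ^ (a - 1)) := by
    nlinarith [mul_le_mul_of_nonneg_left hz1 (mul_pos hC h3).le]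
  have h5 := le_of_mul_le_mul_left h4 hz0
  have h6 := rpow_comp 2 z (m + 1) (a - 1) (by norm_num) (by linarith) (by rw [hz]; linarith)
    (by rw [hz]; linarith)
  calc _ ≤ _ := h5
    _ ≤ (C + 1) * (2 ^ |a - 1| * (m + 1) ^ (a - 1)) := by gcongr
    _ = _ := by ring

lemma sq_rpow (s b : ℝ) (hs : 0 < s) : (s ^ b) ^ 2 = s ^ (2 * b) := by
  rw [← Real.rpow_natCast, ← Real.rpow_mul hs.le]; congr 1; push_cast; ring

lemma en_le (a : ℝ) (ha : 1/2 < a) : ∃ C : ℝ, 0 < C ∧ ∀ m j : ℝ, 1 ≤ j → 2 * j ≤ m →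
    |en a m j| ≤ C * j ^ (-2 : ℝ) := by
  set d := |(1 - a ^ 2) / 4| with hd
  refine ⟨16 * (d * ((2 * a + 2) * ((a + 1) * (a + 3)) + d) + (a - 1) ^ 2 + 1), ?_, fun m j hj hm => ?_⟩
  · have : 0 ≤ d := abs_nonneg _
    positivity
  have hd0 : 0 ≤ d := abs_nonneg _
  have hj0 : 0 < j := by linarith
  have hV1 : m * j / 2 ≤ Vn a m j := by
    unfold Vn
    have := mul_le_mul (show j ≤ j + a/2 + 1/2 by linarith) (show m / 2 ≤ m - j + a/2 + 1 by linarith)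
      (by linarith) (by linarith)
    linarith
  have hV2 : m * j / 4 ≤ Vn a m (j - 1) := by
    unfold Vn
    have := mul_le_mul (show j / 2 ≤ j - 1 + a/2 + 1/2 by linarith)
      (show m / 2 ≤ m - (j - 1) + a/2 + 1 by linarith)
      (by linarith) (by linarith)
    linarith
  have hm0 : 0 < m := by linarith
  have hVV : (m * j) ^ 2 / 8 ≤ Vn a m j * Vn a m (j - 1) := by
    have := mul_le_mul hV1 hV2 (by positivity) (le_trans (by positivity) hV1)
    nlinarith
  have hu : |un a m j - 1/4| ≤ (a + 1) * (a + 3) * m ^ 2 := by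
    have h1 : 1/4 ≤ un a m j := by
      unfold un
      have := mul_le_mul (show (1:ℝ) ≤ j + a/2 by linarith) (show (1:ℝ) ≤ m - j + a/2 + 3/2 by linarith)
        (by linarith) (by linarith)
      linarith
    rw [abs_of_nonneg (by linarith)]
    have h2 : un a m j ≤ ((a + 1) * m) * ((a + 3) * m) := by
      unfold un
      apply mul_le_mul
      · nlinarith
      · nlinarith
      · linarith
      · positivity
    nlinarith
  have hN : Nn m j ^ 2 ≤ (2 * m) ^ 2 := by
    unfold Nn
    apply pow_le_pow_left₀ <;> linarith
  have hm2 : 1 ≤ m ^ 2 := by nlinarith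
  have hE : |En a m j| ≤ (d * ((2 * a + 2) * ((a + 1) * (a + 3)) + d) + (a - 1) ^ 2 + 1) * m ^ 2 := by
    unfold En
    have h1 : |(2 * a - 2) * (un a m j - 1/4) - (1 - a ^ 2) / 4| ≤
        (2 * a + 2) * ((a + 1) * (a + 3) * m ^ 2) + d * m ^ 2 := by
      refine (abs_sub _ _).trans ?_
      rw [abs_mul]
      apply add_le_add
      · apply mul_le_mul _ hu (abs_nonneg _) (by linarith)
        rw [abs_le]; constructor <;> linarith
      · rw [← hd]; nlinarith
    refine (abs_sub _ _).trans ?_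
    rw [abs_mul, ← hd, abs_of_nonneg (show 0 ≤ (a - 1) ^ 2 * Nn m j ^ 2 / 4 by positivity)]
    have h2 := mul_le_mul_of_nonneg_left h1 hd0
    have h3 := mul_le_mul_of_nonneg_left hN (sq_nonneg (a - 1))
    nlinarith
  unfold en
  have hp : 0 < (m * j) ^ 2 / 8 := by positivity
  rw [abs_div, abs_of_pos (hp.trans_le hVV), div_le_iff₀ (hp.trans_le hVV)]
  have e : j ^ (-2 : ℝ) = (j ^ 2)⁻¹ := by
    rw [Real.rpow_neg hj0.le]; norm_cast
  set c := d * ((2 * a + 2) * ((a + 1) * (a + 3)) + d) + (a - 1) ^ 2 + 1 with hc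
  have hc0 : 0 ≤ c := by rw [hc]; positivity
  calc |En a m j| ≤ c * m ^ 2 := hE
    _ ≤ 16 * c * j ^ (-2 : ℝ) * ((m * j) ^ 2 / 8) := by
      rw [e]; field_simp; nlinarith [mul_nonneg hc0 (sq_nonneg m)]
    _ ≤ _ := by gcongr

noncomputable def S0 (a : ℝ) (m : ℕ) : ℝ := ∑ j ∈ range (m / 2 + 1), g a m j * Nn m j

lemma half_facts (m : ℕ) : 2 * ((m / 2 : ℕ) : ℝ) ≤ m ∧ (m : ℝ) ≤ 2 * ((m / 2 : ℕ) : ℝ) + 1 := by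
  constructor
  · have : 2 * (m / 2) ≤ m := by omega
    exact_mod_cast this
  · have : m ≤ 2 * (m / 2) + 1 := by omega
    exact_mod_cast this

lemma S0_est (a : ℝ) (ha : 1/2 < a) : ∃ C : ℝ, 0 < C ∧ ∀ m : ℕ,
    |(2 * a - 1) * S0 a m - Rn a m (m / 2 : ℕ) / Vn a m (m / 2 : ℕ)|
      ≤ C * ((m : ℝ) + 1) ^ (2 * a - 1 + max (2 * a - 2) 0) := by
  have ha0 : 0 < a := by linarith
  obtain ⟨CA, hCA, hA⟩ := A_le a ha0
  obtain ⟨CB, hCB, hB⟩ := B_le a ha0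
  obtain ⟨CE, hCE, hE⟩ := en_le a ha
  obtain ⟨CS, hCS, hS⟩ := sum_bound (2 * a - 2)
  have hA0 := A_pos a ha0 0 le_rfl
  refine ⟨A a 0 ^ 2 * CB ^ 2 * (2 * (2 * a - 1) + 8 * a ^ 2) + CA ^ 2 * CB ^ 2 * 2 * CE * CS, ?_, fun m => ?_⟩
  · have : 0 < 2 * a - 1 := by linarith
    positivity
  obtain ⟨hJ1, hJ2⟩ := half_facts m
  set J := m / 2 with hJ
  set s : ℝ := (m : ℝ) + 1 with hs
  have hm0 : (0 : ℝ) ≤ m := by positivity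
  have hs1 : 1 ≤ s := by linarith
  have hs0 : 0 < s := by linarith
  have hQ := Q_sum a ha0 m J (by omega)
  have e1 : S0 a m = ∑ j ∈ range J, g a m (j + 1) * Nn m (j + 1) + g a m 0 * Nn m 0 := by
    unfold S0; rw [Finset.sum_range_succ']; push_cast; rfl
  have e2 : ∑ j ∈ range J, g a m (j + 1) * (Nn m (j + 1) * (2 * a - 1 + en a m (j + 1)))
     = (2 * a - 1) * ∑ j ∈ range J, g a m (j + 1) * Nn m (j + 1)
        + ∑ j ∈ range J, g a m (j + 1) * Nn m (j + 1) * en a m (j + 1) := by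
    rw [Finset.mul_sum, ← Finset.sum_add_distrib]
    apply Finset.sum_congr rfl; intro j _; ring
  rw [e2] at hQ
  have e3 : (2 * a - 1) * S0 a m - Rn a m J / Vn a m J =
      ((2 * a - 1) * (g a m 0 * Nn m 0) - Rn a m 0 / Vn a m 0)
        - ∑ j ∈ range J, g a m (j + 1) * Nn m (j + 1) * en a m (j + 1) := by
    rw [e1]; linarith
  rw [e3]
  have hpow1 : s ^ (2 * a - 2) * s = s ^ (2 * a - 1) := by
    rw [← Real.rpow_add_one hs0.ne']; congr 1; ring
  have hB2 : ∀ j : ℝ, 0 ≤ j → 2 * j ≤ m → B a (m - j) ^ 2 ≤ CB ^ 2 * s ^ (2 * a - 2) := by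
    intro j hj hjm
    have h1 := hB m j hj hjm
    have h2 := pow_le_pow_left₀ (B_pos a ha0 _ (by linarith)).le h1 2
    rw [mul_pow, sq_rpow _ _ hs0] at h2
    rwa [show 2 * a - 2 = 2 * (a - 1) by ring]
  have hg0 : g a m 0 ≤ A a 0 ^ 2 * (CB ^ 2 * s ^ (2 * a - 2)) := by
    unfold g
    gcongr
    exact hB2 0 le_rfl (by linarith)
  have hg0' : 0 ≤ g a m 0 := by unfold g; positivity
  have hmono : s ^ (2 * a - 1) ≤ s ^ (2 * a - 1 + max (2 * a - 2) 0) :=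
    Real.rpow_le_rpow_of_exponent_le hs1 (by linarith [le_max_right (2 * a - 2) 0])
  have b1 : |(2 * a - 1) * (g a m 0 * Nn m 0) - Rn a m 0 / Vn a m 0| ≤
      A a 0 ^ 2 * CB ^ 2 * (2 * (2 * a - 1) + 8 * a ^ 2) * s ^ (2 * a - 1) := by
    have hN0 : Nn m 0 ≤ 2 * s := by unfold Nn; linarith
    have hN0' : 0 ≤ Nn m 0 := by unfold Nn; linarith
    have hx : g a m 0 * Nn m 0 ≤ A a 0 ^ 2 * (CB ^ 2 * s ^ (2 * a - 2)) * (2 * s) := by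
      gcongr
    have hV := Vn_pos a ha0 m 0 le_rfl hm0
    have hy : Rn a m 0 / Vn a m 0 ≤ A a 0 ^ 2 * (CB ^ 2 * s ^ (2 * a - 2)) * (8 * a ^ 2 * s) := by
      rw [div_le_iff₀ hV]
      have hV' : s / 2 ≤ Vn a m 0 := by
        unfold Vn
        have := mul_le_mul (show (1/2 : ℝ) ≤ 0 + a/2 + 1/2 by linarith)
          (show s ≤ m - 0 + a/2 + 1 by linarith) hs0.le (by linarith)
        linarith
      calc Rn a m 0 = g a m 0 * (a ^ 2 * (m + 3/2) ^ 2) := by unfold Rn; ring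
        _ ≤ (A a 0 ^ 2 * (CB ^ 2 * s ^ (2 * a - 2))) * (a ^ 2 * (2 * s) ^ 2) := by
          gcongr; linarith
        _ = A a 0 ^ 2 * (CB ^ 2 * s ^ (2 * a - 2)) * (8 * a ^ 2 * s) * (s / 2) := by ring
        _ ≤ _ := by gcongr
    have hy0 : 0 ≤ Rn a m 0 / Vn a m 0 := by
      apply div_nonneg _ hV.le
      unfold Rn; positivity
    have hx0 : 0 ≤ (2 * a - 1) * (g a m 0 * Nn m 0) :=
      mul_nonneg (by linarith) (mul_nonneg hg0' hN0')
    refine (abs_sub _ _).trans ?_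
    rw [abs_of_nonneg hx0, abs_of_nonneg hy0, ← hpow1]
    have hx2 := mul_le_mul_of_nonneg_left hx (show 0 ≤ 2 * a - 1 by linarith)
    linarith
  have b2 : |∑ j ∈ range J, g a m (j + 1) * Nn m (j + 1) * en a m (j + 1)| ≤
      CA ^ 2 * CB ^ 2 * 2 * CE * CS * s ^ (2 * a - 1 + max (2 * a - 2) 0) := by
    refine (Finset.abs_sum_le_sum_abs _ _).trans ?_
    have : ∀ j ∈ range J, |g a m (j + 1) * Nn m (j + 1) * en a m (j + 1)| ≤
        (CA ^ 2 * CB ^ 2 * 2 * CE * s ^ (2 * a - 1)) * ((j : ℝ) + 1) ^ (2 * a - 2 - 2) := by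
      intro j hj
      have hj' : (j : ℝ) + 1 ≤ J := by exact_mod_cast Finset.mem_range.1 hj
      have hj0 : (0 : ℝ) ≤ j := by positivity
      have hA2 : A a (j + 1) ^ 2 ≤ CA ^ 2 * ((j : ℝ) + 1) ^ (2 * a - 2) := by
        have h2 := pow_le_pow_left₀ (A_pos a ha0 _ (by linarith)).le (hA (j + 1) (by linarith)) 2
        rw [mul_pow, sq_rpow _ _ (by linarith)] at h2
        rwa [show 2 * a - 2 = 2 * (a - 1) by ring]
      have hB2' := hB2 (j + 1) (by linarith) (by linarith)
      have hE' := hE m (j + 1) (by linarith) (by linarith)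
      have hN : |Nn m (j + 1)| ≤ 2 * s := by
        unfold Nn; rw [abs_le]; constructor <;> linarith
      have hp : ((j : ℝ) + 1) ^ (2 * a - 2 - 2) = ((j : ℝ) + 1) ^ (2 * a - 2) * ((j : ℝ) + 1) ^ (-2 : ℝ) := by
        rw [← Real.rpow_add (by linarith)]; congr 1
      rw [abs_mul, abs_mul, abs_of_nonneg (show 0 ≤ g a m (j + 1) by unfold g; positivity), hp, ← hpow1]
      calc _ ≤ ((CA ^ 2 * ((j : ℝ) + 1) ^ (2 * a - 2)) * (CB ^ 2 * s ^ (2 * a - 2))) * (2 * s)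
            * (CE * ((j : ℝ) + 1) ^ (-2 : ℝ)) := by
            unfold g
            gcongr
        _ = _ := by ring
    refine (Finset.sum_le_sum this).trans ?_
    rw [← Finset.mul_sum, Real.rpow_add hs0]
    have := hS J s hs1 (by linarith)
    calc _ ≤ (CA ^ 2 * CB ^ 2 * 2 * CE * s ^ (2 * a - 1)) * (CS * s ^ max (2 * a - 2) 0) := by
          gcongr
      _ = _ := by ring
  refine (abs_sub _ _).trans ?_
  have hpos : 0 ≤ A a 0 ^ 2 * CB ^ 2 * (2 * (2 * a - 1) + 8 * a ^ 2) := by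
    have : 0 < 2 * a - 1 := by linarith
    positivity
  have := mul_le_mul_of_nonneg_left hmono hpos
  linarith

/-- the Gamma ratio near `t` -/
lemma gr_near (a : ℝ) (ha : 0 < a) : ∃ C : ℝ, 0 < C ∧ ∀ s z : ℝ, 1 ≤ s → 1 ≤ z → |z - s / 2| ≤ 2 →
    |Real.Gamma (z + a) / Real.Gamma z - (s / 2) ^ a| ≤ C * s ^ (a - 1) := by
  obtain ⟨C, hC, h⟩ := gr a ha.le
  refine ⟨C * 8 ^ |a - 1| + |a| * 8 ^ |a - 1| * 2 * 2 ^ |a - 1|, by positivity, fun s z hs hz hsz => ?_⟩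
  obtain ⟨h1, h2⟩ := abs_le.1 hsz
  have hs0 : 0 < s := by linarith
  have b1 := h z hz
  have b2 := rpow_diff 8 a z (s / 2) 2 (by norm_num) (by linarith) (by linarith) (by linarith) hsz
  have b3 := rpow_comp 8 z s (a - 1) (by norm_num) hs0 (by linarith) (by linarith)
  have b4 := rpow_comp 2 (s / 2) s (a - 1) (by norm_num) hs0 (by linarith) (by linarith)
  calc _ = |(Real.Gamma (z + a) / Real.Gamma z - z ^ a) + (z ^ a - (s / 2) ^ a)| := by congr 1; ring
    _ ≤ _ := abs_add_le _ _
    _ ≤ C * (8 ^ |a - 1| * s ^ (a - 1)) + |a| * 8 ^ |a - 1| * 2 * (2 ^ |a - 1| * s ^ (a - 1)) := by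
      apply add_le_add
      · exact b1.trans (by gcongr)
      · exact b2.trans (by gcongr)
    _ = _ := by ring

set_option maxHeartbeats 1000000 in
lemma Rn_est (a : ℝ) (ha : 0 < a) : ∃ C : ℝ, 0 < C ∧ ∀ m : ℕ,
    |Rn a m (m / 2 : ℕ) - (((m : ℝ) + 1) / 2) ^ (4 * a)| ≤ C * ((m : ℝ) + 1) ^ (4 * a - 1) := by
  obtain ⟨C, hC, h⟩ := gr_near a ha
  refine ⟨C * (C + 1) * (C + 2) ^ 2 * 2 + C * (C + 2) * 2 , by positivity, fun m => ?_⟩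
  obtain ⟨hJ1, hJ2⟩ := half_facts m
  set J := m / 2 with hJ
  set s : ℝ := (m : ℝ) + 1 with hs
  have hm0 : (0 : ℝ) ≤ m := by positivity
  have hj0 : (0 : ℝ) ≤ J := by positivity
  have hs1 : 1 ≤ s := by linarith
  have hs0 : 0 < s := by linarith
  have r1 := h s (J + 1) hs1 (by linarith) (by rw [abs_le]; constructor <;> linarith)
  have r2 := h s (m - J + 3/2) hs1 (by linarith) (by rw [abs_le]; constructor <;> linarith)
  rw [← B_eq a (m - J) (by linarith)] at r2
  have e1 : Real.Gamma (J + 1 + a) / Real.Gamma (J + 1) = (J + a) * A a J := by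
    unfold A
    rw [show (J : ℝ) + 1 + a = (J + a) + 1 by ring, Real.Gamma_add_one (by positivity)]
    ring
  rw [e1] at r1
  set p := (J + a) * A a J with hp
  set q := ((m : ℝ) - J + 3/2) * B a (m - J) with hq
  have e2 : Rn a m J = (p * q) ^ 2 := by rw [hp, hq]; unfold Rn g; ring
  set t := (s / 2) ^ a with ht
  have ht0 : 0 < t := by positivity
  have e3 : (s / 2) ^ (4 * a) = (t * t) ^ 2 := by
    rw [ht, ← Real.rpow_add (by positivity), sq_rpow _ _ (by positivity)]; congr 1; ring
  rw [e2, e3]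
  set σ := s ^ (a - 1) with hσ
  have hσ0 : 0 < σ := by positivity
  have e4 : s ^ a = σ * s := by rw [hσ, ← Real.rpow_add_one hs0.ne']; congr 1; ring
  have e5 : s ^ (4 * a - 1) = σ ^ 4 * s ^ 3 := by
    rw [hσ, ← Real.rpow_natCast, ← Real.rpow_natCast, ← Real.rpow_mul hs0.le, ← Real.rpow_add hs0]
    congr 1; push_cast; ring
  have htle : t ≤ σ * s := by
    rw [← e4, ht]; apply Real.rpow_le_rpow (by positivity) (by linarith) ha.le
  clear_value σ t p q
  have hσs : σ ≤ σ * s := by nlinarith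
  have hp1 : |p| ≤ (C + 1) * (σ * s) := by
    have := abs_sub_abs_le_abs_sub p t
    rw [abs_of_pos ht0] at this
    nlinarith
  have hq1 : |q| ≤ (C + 1) * (σ * s) := by
    have := abs_sub_abs_le_abs_sub q t
    rw [abs_of_pos ht0] at this
    nlinarith
  have hpq : |p * q - t * t| ≤ C * (C + 2) * (σ * (σ * s)) := by
    have : p * q - t * t = (p - t) * q + t * (q - t) := by ring
    rw [this]
    refine (abs_add_le _ _).trans ?_
    rw [abs_mul, abs_mul, abs_of_pos ht0]
    calc _ ≤ (C * σ) * ((C + 1) * (σ * s)) + (σ * s) * (C * σ) := by gcongr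
      _ = _ := by ring
  have hpq2 : |p * q + t * t| ≤ ((C + 1) ^ 2 + 1) * (σ * s) ^ 2 := by
    refine (abs_add_le _ _).trans ?_
    rw [abs_mul, abs_mul, abs_of_pos ht0]
    calc _ ≤ ((C + 1) * (σ * s)) * ((C + 1) * (σ * s)) + (σ * s) * (σ * s) := by gcongr
      _ = _ := by ring
  have : (p * q) ^ 2 - (t * t) ^ 2 = (p * q - t * t) * (p * q + t * t) := by ring
  rw [this, abs_mul, e5]
  calc _ ≤ (C * (C + 2) * (σ * (σ * s))) * (((C + 1) ^ 2 + 1) * (σ * s) ^ 2) := by gcongr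
    _ = (C * (C + 2) * ((C + 1) ^ 2 + 1)) * (σ ^ 4 * s ^ 3) := by ring
    _ ≤ _ := by
      gcongr
      have : 0 ≤ C ^ 2 := sq_nonneg C
      have : 0 ≤ C ^ 3 := by positivity
      have : 0 ≤ C ^ 4 := by positivity
      nlinarith

set_option maxHeartbeats 1000000 in
lemma T_est (a : ℝ) (ha : 1/2 < a) : ∃ C : ℝ, 0 < C ∧ ∀ m : ℕ,
    |T a m - 2 / (a * (2 * a - 1)) * (((m : ℝ) + 1) / 2) ^ (4 * a)|
      ≤ C * ((m : ℝ) + 1) ^ (max (4 * a - 1) (2 * a + 1)) := by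
  have ha0 : 0 < a := by linarith
  have ha1 : 0 < 2 * a - 1 := by linarith
  obtain ⟨C1, hC1, h1⟩ := S0_est a ha
  obtain ⟨C2, hC2, h2⟩ := Rn_est a ha0
  refine ⟨((2 / a) * C2 + (8 + a ^ 2) * 8 * (C2 + 1) + (a + 2) ^ 2 * 2 * C1) / (2 * a - 1), by positivity, fun m => ?_⟩
  have hR := R_sum a ha0 m (m / 2) (by omega)
  specialize h1 m
  specialize h2 m
  obtain ⟨hJ1, hJ2⟩ := half_facts m
  have eT : T a m = (((m : ℝ) + a + 3/2) ^ 2 - 1/4 - a ^ 2) * S0 a m - (2 / a) * Rn a m (m / 2 : ℕ) := by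
    rw [← hR, S0, T, Finset.mul_sum, Finset.mul_sum, ← Finset.sum_sub_distrib]
    apply Finset.sum_congr rfl
    intro j _
    simp only [Nn, un]
    field_simp
    ring
  set J := m / 2 with hJ
  set s : ℝ := (m : ℝ) + 1 with hs
  have hm0 : (0 : ℝ) ≤ m := by positivity
  have hj0 : (0 : ℝ) ≤ J := by positivity
  have hs1 : 1 ≤ s := by linarith
  have hs0 : 0 < s := by linarith
  set E := max (4 * a - 1) (2 * a + 1) with hE
  set R := Rn a m J with hRdef
  set V := Vn a m J with hVdef
  set t4 := (s / 2) ^ (4 * a) with ht4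
  set err := (2 * a - 1) * S0 a m - R / V with herr
  set P := ((m : ℝ) + a + 3/2) ^ 2 - 1/4 - a ^ 2 with hP
  set κ := ((m : ℝ) - 2 * J + 1/2) ^ 2 - 1/4 - a ^ 2 with hκ
  have hV0 : 0 < V := Vn_pos a ha0 m J hj0 (by linarith)
  have hPV : P = 4 * V + κ := by rw [hP, hVdef, hκ]; unfold Vn; ring
  have hκ1 : |κ| ≤ 8 + a ^ 2 := by
    rw [hκ, abs_le]; constructor <;> nlinarith
  have hV1 : s ^ 2 / 8 ≤ V := by
    rw [hVdef]; unfold Vn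
    have := mul_le_mul (show s / 4 ≤ J + a/2 + 1/2 by linarith) (show s / 2 ≤ m - J + a/2 + 1 by linarith)
      (by linarith) (by linarith)
    linarith
  have hmain : (2 * a - 1) * (T a m - 2 / (a * (2 * a - 1)) * t4)
      = (2 / a) * (R - t4) + κ * (R / V) + P * err := by
    rw [eT, herr]
    have : P * (R / V) = 4 * R + κ * (R / V) := by rw [hPV]; field_simp
    have e : (2 * a - 1) * (2 / (a * (2 * a - 1)) * t4) = 2 / a * t4 := by field_simp
    have e' : (2 * a - 1) * (2 / a * R) = 4 * R - 2 / a * R := by field_simp; ring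
    linear_combination this - e - e'
  have p1 : s ^ (4 * a - 1) ≤ s ^ E := Real.rpow_le_rpow_of_exponent_le hs1 (le_max_left _ _)
  have p2 : s ^ (4 * a) = s ^ (4 * a - 1) * s := by
    rw [← Real.rpow_add_one hs0.ne']; congr 1; ring
  have p3 : s ^ (2 * a - 1 + max (2 * a - 2) 0) * s ^ 2 = s ^ E := by
    rw [← Real.rpow_natCast s 2, ← Real.rpow_add hs0]; congr 1
    rw [hE]; push_cast
    rcases le_total (2 * a - 2) 0 with h | h
    · rw [max_eq_right h, max_eq_right (by linarith)]; ring
    · rw [max_eq_left h, max_eq_left (by linarith)]; ring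
  have hσ0 : 0 < s ^ (4 * a - 1) := by positivity
  have hR1 : |R| ≤ (C2 + 1) * (s ^ (4 * a - 1) * s) := by
    have h3 := abs_sub_abs_le_abs_sub R t4
    have ht40 : 0 < t4 := by positivity
    have : t4 ≤ s ^ (4 * a) := Real.rpow_le_rpow (by positivity) (by linarith) (by linarith)
    rw [abs_of_pos ht40] at h3
    rw [p2] at this
    nlinarith [mul_le_mul_of_nonneg_left hs1 (mul_pos hC2 hσ0).le]
  have hP1 : |P| ≤ (a + 2) ^ 2 * 2 * s ^ 2 := by
    have h6 : (a + 2) * 1 ≤ (a + 2) * s := mul_le_mul_of_nonneg_left hs1 (by linarith)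
    have h7 : a * 1 ≤ a * s := mul_le_mul_of_nonneg_left hs1 ha0.le
    have h3 : ((m : ℝ) + a + 3/2) ^ 2 ≤ ((a + 2) * s) ^ 2 :=
      pow_le_pow_left₀ (by positivity) (by linarith) 2
    have h4 : ((a + 2) * 1) ^ 2 ≤ ((a + 2) * s) ^ 2 := pow_le_pow_left₀ (by linarith) h6 2
    have h5 : 0 ≤ ((m : ℝ) + a + 3/2) ^ 2 := sq_nonneg _
    have h8 : ((a + 2) * s) ^ 2 = (a + 2) ^ 2 * s ^ 2 := by ring
    have h9 : ((a + 2) * 1) ^ 2 = a ^ 2 + 4 * a + 4 := by ring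
    have h10 : 0 ≤ a ^ 2 := sq_nonneg _
    rw [h8] at h3 h4
    rw [h9] at h4
    rw [hP, abs_le, mul_assoc, mul_left_comm]
    constructor <;> linarith
  clear hJ hR eT hPV
  clear_value err R V t4 P κ E s
  have hRV : |R / V| ≤ 8 * (C2 + 1) * s ^ (4 * a - 1) := by
    rw [abs_div, abs_of_pos hV0, div_le_iff₀ hV0]
    refine hR1.trans ?_
    calc _ ≤ (C2 + 1) * (s ^ (4 * a - 1) * s ^ 2) := by gcongr; nlinarith
      _ = 8 * (C2 + 1) * s ^ (4 * a - 1) * (s ^ 2 / 8) := by ring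
      _ ≤ _ := by gcongr
  have hfin : |(2 * a - 1) * (T a m - 2 / (a * (2 * a - 1)) * t4)| ≤
      ((2 / a) * C2 + (8 + a ^ 2) * 8 * (C2 + 1) + (a + 2) ^ 2 * 2 * C1) * s ^ E := by
    rw [hmain]
    refine (abs_add_le _ _).trans ((add_le_add_left (abs_add_le _ _) _).trans ?_)
    rw [abs_mul, abs_mul, abs_mul, abs_of_pos (show 0 < 2 / a by positivity)]
    calc _ ≤ 2 / a * (C2 * s ^ E) + (8 + a ^ 2) * (8 * (C2 + 1) * s ^ E)
          + ((a + 2) ^ 2 * 2 * s ^ 2) * (C1 * s ^ (2 * a - 1 + max (2 * a - 2) 0)) := by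
          gcongr
          · exact h2.trans (by gcongr)
          · exact hRV.trans (by gcongr)
      _ = _ := by rw [← p3]; ring
  rw [abs_mul, abs_of_pos ha1] at hfin
  refine le_of_mul_le_mul_left (a := 2 * a - 1) ?_ ha1
  refine hfin.trans (le_of_eq ?_)
  field_simp

end GegAux

theorem gegenbauer_weighted_L2_norm_asymptotic_large_lambda (lam : ℝ) (hlam : 1 < lam) :
    ∃ (C : ℝ) (N : ℕ), 0 < C ∧ ∀ n : ℕ, N ≤ n →
      |(∫ x in (0:ℝ)..1, (1 - x ^ 2) * (gegenbauer (lam + 1) (n - 1) x) ^ 2)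
        - ((2 * lam - 1) / (4 * (lam - 1) * Real.Gamma (2 * lam + 1) ^ 2))
            * (n : ℝ) ^ (4 * lam - 2)|
      ≤ C * (n : ℝ) ^ (max (4 * (lam - 1) - 1) (2 * (lam - 1)) + 2) := by
  obtain ⟨a, rfl⟩ : ∃ a, lam = a + 1/2 := ⟨lam - 1/2, by ring⟩
  have ha : 1/2 < a := by linarith
  have ha0 : 0 < a := by linarith
  obtain ⟨C, hC, h⟩ := GegAux.T_est a ha
  set K := 3/2 * GegAux.A a 0 * GegAux.B a 0 with hK
  have hK0 : 0 < K := by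
    have := GegAux.A_pos a ha0 0 le_rfl
    have := GegAux.B_pos a ha0 0 le_rfl
    positivity
  refine ⟨C / (2 * K ^ 2), 1, by positivity, fun n hn => ?_⟩
  obtain ⟨m, rfl⟩ : ∃ m, n = m + 1 := ⟨n - 1, by omega⟩
  have hI := GegAux.int_formula a ha0 m
  rw [← hK] at hI
  specialize h m
  rw [Nat.add_sub_cancel, show a + 1/2 + 1 = a + 3/2 by ring]
  push_cast
  set s : ℝ := (m : ℝ) + 1 with hs
  have hs0 : 0 < s := by positivity
  set I := ∫ x in (0:ℝ)..1, (1 - x ^ 2) * (gegenbauer (a + 3/2) m x) ^ 2 with hIdef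
  have hexp : max (4 * (a + 1/2 - 1) - 1) (2 * (a + 1/2 - 1)) + 2 = max (4 * a - 1) (2 * a + 1) := by
    rw [← max_add_add_right]; congr 1 <;> ring
  have hconst : (2 * (a + 1/2) - 1) / (4 * (a + 1/2 - 1) * Real.Gamma (2 * (a + 1/2) + 1) ^ 2)
      * s ^ (4 * (a + 1/2) - 2) = (2 / (a * (2 * a - 1)) * (s / 2) ^ (4 * a)) / (2 * K ^ 2) := by
    have hdup := Real.Gamma_mul_Gamma_add_half (a + 1)
    rw [Real.Gamma_add_one ha0.ne', show a + 1 + 1/2 = a + 3/2 by ring] at hdup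
    have hG52 : Real.Gamma (5/2) = 3/4 * √π := by
      rw [show (5/2 : ℝ) = (1/2 + 1) + 1 by norm_num, Real.Gamma_add_one (by norm_num),
        Real.Gamma_add_one (by norm_num), Real.Gamma_one_half_eq]; ring
    have hKe : K * (a * (3/4)) * √π = 3/2 * (a * Real.Gamma a * Real.Gamma (a + 3/2)) := by
      have hpi : √π ≠ 0 := by positivity
      rw [hK]; unfold GegAux.A GegAux.B
      simp only [zero_add, Real.Gamma_one]
      rw [hG52]; field_simp
    rw [hdup] at hKe
    have hKe' : K * a = 2 * Real.Gamma (2 * (a + 1)) * 2 ^ (1 - 2 * (a + 1)) := by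
      have hpi : √π ≠ 0 := by positivity
      apply mul_right_cancel₀ hpi
      linear_combination (4/3 : ℝ) * hKe
    have h2pow : (2 : ℝ) ^ (1 - 2 * (a + 1)) = (2 * 2 ^ (2 * a))⁻¹ := by
      rw [show 1 - 2 * (a + 1) = -(1 + 2 * a) by ring, Real.rpow_neg (by norm_num), Real.rpow_add (by norm_num),
        Real.rpow_one]
    have h2p0 : (0 : ℝ) < 2 ^ (2 * a) := by positivity
    have h4 : (2 : ℝ) ^ (4 * a) = (2 ^ (2 * a)) ^ 2 := by
      rw [GegAux.sq_rpow _ _ (by norm_num)]; congr 1; ring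
    have hGam : Real.Gamma (2 * (a + 1/2) + 1) = K * a * 2 ^ (2 * a) := by
      rw [hKe', h2pow, show 2 * (a + 1/2) + 1 = 2 * (a + 1) by ring]; field_simp
    rw [hGam, Real.div_rpow hs0.le (by norm_num), h4, show 4 * (a + 1/2) - 2 = 4 * a by ring]
    have : 2 * a - 1 ≠ 0 := by linarith
    have : a + 1/2 - 1 ≠ 0 := by linarith
    rw [show a + 1/2 - 1 = (2 * a - 1) / 2 by ring, show 2 * (a + 1/2) - 1 = 2 * a by ring]
    field_simp
    ring
  rw [hexp, hconst]
  have hIe : I = GegAux.T a m / (2 * K ^ 2) := by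
    rw [eq_div_iff (by positivity)]; linarith
  rw [hIe, ← sub_div, abs_div, abs_of_pos (show 0 < 2 * K ^ 2 by positivity), div_mul_eq_mul_div C]
  exact div_le_div_of_nonneg_right h (show 0 ≤ 2 * K ^ 2 by positivity)
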